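/- Let f ∈ H_0^{1,∞} and suppose there exists F ∈ H_0^{1,∞} whose boundary function equals the complex conjugate of the boundary function of f a.e. on T. Then f is a constant function on D. -/

import Mathlib

open MeasureTheory Complex Filter Set Metric
open scoped ComplexConjugate

noncomputable section

/-- The circle group `ℝ / 2πℤ`, parametrizing the unit circle `𝕋`. -/
instance fact_two_pi_pos : Fact (0 < 2 * Real.pi) := ⟨by positivity⟩

abbrev Tc : Type := AddCircle (2 * Real.pi)

/-- Normalized Lebesgue measure on the circle. -/
def m : Measure Tc := AddCircle.haarAddCircle

instance : IsProbabilityMeasure m := by unfold m; infer_instance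

/-- The point `e^{iθ}` of the unit circle corresponding to `θ ∈ ℝ/2πℤ`. -/
def bd (θ : Tc) : ℂ := (AddCircle.toCircle θ : ℂ)

/-- The open unit disc. -/
abbrev uDisc : Set ℂ := Metric.ball (0 : ℂ) 1

/-- A function holomorphic on the open unit disc. -/
def HolDisc (f : ℂ → ℂ) : Prop := DifferentiableOn ℂ f uDisc

/-- `F` is the radial (a.e.) boundary function of `f`. -/
def IsBdry (f : ℂ → ℂ) (F : Tc → ℂ) : Prop :=
  ∀ᵐ θ ∂m, Tendsto (fun r : ℝ => f ((r : ℂ) * bd θ)) (nhdsWithin 1 (Set.Iio 1)) (nhds (F θ))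

/-- Membership in the Hardy space `H^p` of the unit disc, `0 < p < ∞`. -/
def MemHp (p : ℝ) (f : ℂ → ℂ) : Prop :=
  HolDisc f ∧ ∃ C : ℝ, ∀ r : ℝ, 0 ≤ r → r < 1 →
    (∫ θ : Tc, ‖f ((r : ℂ) * bd θ)‖ ^ p ∂m) ≤ C

/-- Membership in `H^∞`: bounded holomorphic functions on the disc. -/
def MemHinf (f : ℂ → ℂ) : Prop := HolDisc f ∧ ∃ C : ℝ, ∀ z ∈ uDisc, ‖f z‖ ≤ C

/-- Outer functions on the unit disc. -/
def OuterFn (f : ℂ → ℂ) : Prop :=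
  HolDisc f ∧ ∃ (α : ℂ) (w : Tc → ℝ), ‖α‖ = 1 ∧ (∀ θ, 0 ≤ w θ) ∧
    Integrable (fun θ => Real.log (w θ)) m ∧
    ∀ z ∈ uDisc,
      f z = α * Complex.exp (∫ θ : Tc, ((bd θ + z) / (bd θ - z)) * (Real.log (w θ) : ℂ) ∂m)

/-- Inner functions: `Θ` holomorphic bounded by one, with unimodular boundary values `Θs`. -/
def InnerFn (Θ : ℂ → ℂ) (Θs : Tc → ℂ) : Prop :=
  HolDisc Θ ∧ (∀ z ∈ uDisc, ‖Θ z‖ ≤ 1) ∧ IsBdry Θ Θs ∧ (∀ᵐ θ ∂m, ‖Θs θ‖ = 1)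

/-- `L²(𝕋, m)`. -/
abbrev L2 : Type := Lp ℂ 2 m

/-- The Hardy space `H²`, viewed inside `L²(𝕋)` as the functions whose negative
Fourier coefficients vanish. -/
def H2 : Set L2 := {F | ∀ n : ℤ, n < 0 → fourierCoeff (F : Tc → ℂ) n = 0}

/-- The Cauchy kernel `k_λ(z) = 1/(1 - conj(λ) z)`. -/
def ker (lam z : ℂ) : ℂ := (1 - conj lam * z)⁻¹

/-- Divergence of `Σ (1 - |λ_n|)` (for `λ_n` in the unit disc this is the negation of
the Blaschke condition). -/
def NotBlaschke (lam : ℕ → ℂ) : Prop := ¬ Summable (fun n => 1 - ‖lam n‖)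

/-- A bundle recording: a non-constant function `b` in the closed unit ball of `H^∞`
with `log(1 - |b|) ∈ L¹(𝕋)`, its Pythagorean mate `a` (outer, `a(0) > 0`,
`|a|² + |b|² = 1` a.e.), together with their boundary functions `bs`, `as'`. -/
structure BPair where
  b : ℂ → ℂ
  a : ℂ → ℂ
  bs : Tc → ℂ
  as' : Tc → ℂ
  b_hol : HolDisc b
  b_le_one : ∀ z ∈ uDisc, ‖b z‖ ≤ 1
  b_nonconst : ¬ ∃ c : ℂ, ∀ z ∈ uDisc, b z = c
  b_bdry : IsBdry b bs
  log_int : Integrable (fun θ => Real.log (1 - ‖bs θ‖)) m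
  a_outer : OuterFn a
  a_bdry : IsBdry a as'
  a0_pos : ∃ r : ℝ, 0 < r ∧ a 0 = (r : ℂ)
  pyth : ∀ᵐ θ ∂m, ‖as' θ‖ ^ 2 + ‖bs θ‖ ^ 2 = 1

/-- The defining relation of `H(b)`: `T_{conj b} F = T_{conj a} F⁺`, i.e. all nonnegative
Fourier coefficients of `conj(b)·F - conj(a)·F⁺` vanish, with `F, F⁺ ∈ H²`. -/
def HbMem (P : BPair) (F Fp : L2) : Prop :=
  F ∈ H2 ∧ Fp ∈ H2 ∧ ∀ n : ℤ, 0 ≤ n →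
    fourierCoeff (fun θ => conj (P.bs θ) * (F : Tc → ℂ) θ - conj (P.as' θ) * (Fp : Tc → ℂ) θ) n = 0

/-- The ambient Hilbert space `L² ×_2 L²` in which `H(b)` embeds isometrically via
`f ↦ (f, f⁺)`; its norm is `‖(F, F⁺)‖² = ‖F‖₂² + ‖F⁺‖₂²`, the `H(b)` norm. -/
abbrev HbP : Type := WithLp 2 (L2 × L2)

def fst2 (p : HbP) : L2 := ((WithLp.equiv 2 (L2 × L2)) p).1
def snd2 (p : HbP) : L2 := ((WithLp.equiv 2 (L2 × L2)) p).2

/-- The de Branges–Rovnyak space `H(b)`, as the set of pairs `(f, f⁺)`. -/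
def HbSet (P : BPair) : Set HbP := {p | HbMem P (fst2 p) (snd2 p)}

/-- `q` represents the element `φ · f` of `H(b)`, where `p` represents `f` and `φs` is a
boundary function: `q ∈ H(b)` and the first component of `q` is `φs` times that of `p`. -/
def MulRep (P : BPair) (φs : Tc → ℂ) (p q : HbP) : Prop :=
  q ∈ HbSet P ∧ (fst2 q : Tc → ℂ) =ᵐ[m] fun θ => φs θ * (fst2 p : Tc → ℂ) θ

/-- `Zf` is the family of elements `z^n·f`, `n ≥ 0`, of `H(b)`, where `p` represents `f`. -/
def ZFamily (P : BPair) (p : HbP) (Zf : ℕ → HbP) : Prop :=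
  ∀ n : ℕ, MulRep P (fun θ => (bd θ) ^ n) p (Zf n)

/-- `f` (represented by the pair `p`) is cyclic for `S_b`: the linear span of
`{z^n f : n ≥ 0}` is dense in `H(b)`. -/
def CyclicSb (P : BPair) (p : HbP) : Prop :=
  p ∈ HbSet P ∧ ∀ Zf : ℕ → HbP, ZFamily P p Zf →
    closure (↑(Submodule.span ℂ (Set.range Zf)) : Set HbP) = HbSet P

/-- `FK` is the family of elements `f·k_{λ_n}`, `n ≥ 0`, of `H(b)`. -/
def KFamily (P : BPair) (lam : ℕ → ℂ) (p : HbP) (FK : ℕ → HbP) : Prop :=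
  ∀ n : ℕ, MulRep P (fun θ => ker (lam n) (bd θ)) p (FK n)

/-- `C` is a bound for the norm of the shift `S_b` on `H(b)`. -/
def ShiftBound (P : BPair) (C : ℝ) : Prop :=
  0 ≤ C ∧ ∀ p q : HbP, p ∈ HbSet P → MulRep P (fun θ => bd θ) p q → ‖q‖ ≤ C * ‖p‖

/-- `N = ‖S_b‖`, the operator norm of the shift on `H(b)`. -/
def IsShiftNorm (P : BPair) (N : ℝ) : Prop :=
  ShiftBound P N ∧ ∀ C : ℝ, ShiftBound P C → N ≤ C

/-- `μ` is the Aleksandrov–Clark measure `μ_α` of `b`. -/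
def IsACMeasure (P : BPair) (α : ℂ) (μ : Measure Tc) : Prop :=
  IsFiniteMeasure μ ∧ ∀ z ∈ uDisc,
    (1 - ‖P.b z‖ ^ 2) / ‖1 - conj α * P.b z‖ ^ 2 = ∫ θ : Tc, (1 - ‖z‖ ^ 2) / ‖z - bd θ‖ ^ 2 ∂μ


/-- The Smirnov class `N⁺`: quotients `g/h` with `g, h ∈ H^∞` and `h` outer. -/
def MemSmirnov (f : ℂ → ℂ) : Prop :=
  ∃ g h : ℂ → ℂ, MemHinf g ∧ MemHinf h ∧ OuterFn h ∧ ∀ z ∈ uDisc, f z = g z / h z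

/-- The space `L₀^{1,∞}(𝕋)` : measurable `h` with `m({|h| > t}) = o(1/t)` as `t → ∞`. -/
def MemL1wk0 (h : Tc → ℂ) : Prop :=
  AEStronglyMeasurable h m ∧
    Tendsto (fun t : ℝ => t * (m {θ | t < ‖h θ‖}).toReal) atTop (nhds 0)

/-- `H₀^{1,∞}`: Smirnov-class functions whose boundary function lies in `L₀^{1,∞}(𝕋)`. -/
def MemH1wk0 (f : ℂ → ℂ) (fs : Tc → ℂ) : Prop :=
  MemSmirnov f ∧ IsBdry f fs ∧ MemL1wk0 fs

/-! ### Basic facts on the boundary parametrization and the Poisson kernel -/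

lemma bd_coe (x : ℝ) : bd (x : Tc) = circleMap 0 1 x := by
  unfold bd
  rw [AddCircle.toCircle_apply_mk, Circle.coe_exp, circleMap_zero]
  have : (2 * Real.pi / (2 * Real.pi) * x : ℝ) = x := by
    rw [div_self (by positivity), one_mul]
  rw [this]; simp

@[simp] lemma norm_bd (θ : Tc) : ‖bd θ‖ = 1 :=
  Circle.norm_coe _

lemma continuous_bd : Continuous bd :=
  continuous_subtype_val.comp AddCircle.continuous_toCircle

lemma integral_m {E : Type*} [NormedAddCommGroup E] [NormedSpace ℝ E] (f : Tc → E) :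
    ∫ θ, f θ ∂m = (2 * Real.pi)⁻¹ • ∫ x in (0:ℝ)..2 * Real.pi, f (x : Tc) := by
  have h := AddCircle.intervalIntegral_preimage (2 * Real.pi) 0 f
  rw [zero_add] at h
  rw [h, m, AddCircle.integral_haarAddCircle]

lemma integral_m_bd {E : Type*} [NormedAddCommGroup E] [NormedSpace ℝ E] (f : ℂ → E) :
    ∫ θ, f (bd θ) ∂m = Real.circleAverage f 0 1 := by
  rw [integral_m, Real.circleAverage_def]
  simp_rw [bd_coe]

/-- The Poisson kernel. -/
def Pk (z : ℂ) (θ : Tc) : ℝ := (1 - ‖z‖ ^ 2) / ‖bd θ - z‖ ^ 2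

lemma Pk_eq_poisson (z : ℂ) (θ : Tc) : Pk z θ = poissonKernel 0 z (bd θ) := by
  simp [Pk, poissonKernel]

lemma Pk_eq_re (z : ℂ) (θ : Tc) : Pk z θ = ((bd θ + z) / (bd θ - z)).re := by
  rw [Pk_eq_poisson, poissonKernel_eq_re_herglotzRieszKernel]
  simp [herglotzRieszKernel]

lemma sub_ne {z : ℂ} (hz : ‖z‖ < 1) (θ : Tc) : bd θ - z ≠ 0 := by
  intro h
  have : bd θ = z := sub_eq_zero.mp h
  rw [← this] at hz; simp at hz

lemma Pk_nonneg {z : ℂ} (hz : ‖z‖ < 1) (θ : Tc) : 0 ≤ Pk z θ := by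
  unfold Pk
  have : ‖z‖ ^ 2 ≤ 1 := by nlinarith [norm_nonneg z]
  apply div_nonneg (by linarith) (by positivity)

lemma Pk_le {z : ℂ} (hz : ‖z‖ < 1) (θ : Tc) : Pk z θ ≤ 2 / (1 - ‖z‖) := by
  unfold Pk
  have h1 : 1 - ‖z‖ ≤ ‖bd θ - z‖ := by
    have := norm_sub_norm_le (bd θ) z
    simpa using this
  have h0 : 0 < 1 - ‖z‖ := by linarith
  have hp : 0 < ‖bd θ - z‖ := by linarith
  rw [div_le_div_iff₀ (by positivity) h0]
  nlinarith [norm_nonneg z, mul_le_mul h1 h1 h0.le (by linarith)]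

lemma continuous_Pk {z : ℂ} (hz : ‖z‖ < 1) : Continuous (Pk z) := by
  unfold Pk
  apply Continuous.div continuous_const (by have := continuous_bd; fun_prop)
  intro θ
  have := sub_ne hz θ
  positivity

lemma poisson_formula {z : ℂ} (hz : ‖z‖ < 1) {f : ℂ → ℂ} (hf : DiffContOnCl ℂ f (ball 0 1)) :
    ∫ θ, (Pk z θ : ℂ) * f (bd θ) ∂m = f z := by
  have h := hf.circleAverage_poissonKernel_smul (w := z) (by simpa using hz)
  rw [← integral_m_bd] at h
  rw [← h]
  congr 1; ext θ
  simp [Pk_eq_poisson]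

lemma integral_Pk {z : ℂ} (hz : ‖z‖ < 1) : ∫ θ, Pk z θ ∂m = 1 := by
  have h := poisson_formula hz (f := fun _ => 1) diffContOnCl_const
  simp only [mul_one] at h
  rw [integral_complex_ofReal] at h
  exact_mod_cast h

lemma Pk_symm (r : ℝ) (θ φ : Tc) : Pk (r * bd θ) φ = Pk (r * bd φ) θ := by
  rw [Pk, Pk]
  have : ‖bd φ - r * bd θ‖ ^ 2 = ‖bd θ - r * bd φ‖ ^ 2 := by
    have h1 : ∀ θ, (bd θ).re ^ 2 + (bd θ).im ^ 2 = 1 := fun θ => by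
      have := Complex.sq_norm (bd θ)
      rw [norm_bd, Complex.normSq_apply] at this
      linarith
    simp only [Complex.sq_norm, Complex.normSq_apply, Complex.sub_re, Complex.sub_im,
      Complex.re_ofReal_mul, Complex.im_ofReal_mul]
    have a := h1 θ
    have b := h1 φ
    linear_combination (r ^ 2 - 1) * a + (1 - r ^ 2) * b
  rw [this]; simp

lemma norm_r_bd {r : ℝ} (h0 : 0 ≤ r) (θ : Tc) : ‖(r : ℂ) * bd θ‖ = r := by
  simp [abs_of_nonneg h0]

/-- The Poisson integral. -/
def PI (u : Tc → ℂ) (z : ℂ) : ℂ := ∫ θ, (Pk z θ : ℂ) * u θ ∂m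

lemma integrable_Pk_mul {u : Tc → ℂ} (hu : Integrable u m) {z : ℂ} (hz : ‖z‖ < 1) :
    Integrable (fun θ => (Pk z θ : ℂ) * u θ) m := by
  apply hu.bdd_mul (c := 2 / (1 - ‖z‖))
  · exact (Complex.continuous_ofReal.comp (continuous_Pk hz)).aestronglyMeasurable
  · filter_upwards with θ
    rw [Complex.norm_real, Real.norm_of_nonneg (Pk_nonneg hz θ)]
    exact Pk_le hz θ

lemma integrable_Pk_mul_real {u : Tc → ℝ} (hu : Integrable u m) {z : ℂ} (hz : ‖z‖ < 1) :
    Integrable (fun θ => Pk z θ * u θ) m := by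
  apply hu.bdd_mul (c := 2 / (1 - ‖z‖))
  · exact (continuous_Pk hz).aestronglyMeasurable
  · filter_upwards with θ
    rw [Real.norm_of_nonneg (Pk_nonneg hz θ)]
    exact Pk_le hz θ

lemma PI_ofReal (u : Tc → ℝ) (z : ℂ) :
    PI (fun θ => (u θ : ℂ)) z = ((∫ θ, Pk z θ * u θ ∂m : ℝ) : ℂ) := by
  rw [PI, ← integral_complex_ofReal]
  congr 1; ext θ; push_cast; rfl

/-- The Herglotz integral. -/
def HI (u : Tc → ℝ) (z : ℂ) : ℂ := ∫ θ, ((bd θ + z) / (bd θ - z)) * (u θ : ℂ) ∂m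

lemma integrable_HI {u : Tc → ℝ} (hu : Integrable u m) {z : ℂ} (hz : ‖z‖ < 1) :
    Integrable (fun θ => ((bd θ + z) / (bd θ - z)) * (u θ : ℂ)) m := by
  apply hu.ofReal.bdd_mul (c := 2 / (1 - ‖z‖))
  · apply Continuous.aestronglyMeasurable
    have := continuous_bd
    exact Continuous.div (by fun_prop) (by fun_prop) (sub_ne hz)
  · filter_upwards with θ
    rw [norm_div]
    have h1 : 1 - ‖z‖ ≤ ‖bd θ - z‖ := by
      have := norm_sub_norm_le (bd θ) z
      simpa using this
    have h2 : ‖bd θ + z‖ ≤ 2 := by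
      have := norm_add_le (bd θ) z
      rw [norm_bd] at this; linarith
    have h0 : 0 < 1 - ‖z‖ := by linarith
    exact div_le_div₀ (by norm_num) h2 h0 h1

lemma HI_re {u : Tc → ℝ} (hu : Integrable u m) {z : ℂ} (hz : ‖z‖ < 1) :
    (HI u z).re = ∫ θ, Pk z θ * u θ ∂m := by
  rw [HI]
  have := integral_re (𝕜 := ℂ) (integrable_HI hu hz)
  simp only [RCLike.re_eq_complex_re] at this
  rw [← this]
  congr 1; ext θ
  rw [Pk_eq_re, mul_comm, Complex.re_ofReal_mul, mul_comm]

lemma bd_arg (θ : Tc) : (((Complex.arg (bd θ)) : ℝ) : Tc) = θ := by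
  induction θ using QuotientAddGroup.induction_on with
  | H x =>
    have := Real.Angle.arg_toCircle (x : Real.Angle)
    have h2 : bd ((x:ℝ) : Tc) = (Real.Angle.toCircle (x : Real.Angle) : ℂ) := by
      rw [bd_coe, Real.Angle.toCircle_coe, Circle.coe_exp, circleMap_zero]; simp
    erw [h2]
    exact this

lemma HI_differentiableOn {u : Tc → ℝ} (hu : Integrable u m) :
    DifferentiableOn ℂ (HI u) (ball 0 1) := by
  set g : ℂ → ℂ := fun ζ => (u ((Complex.arg ζ : ℝ) : Tc) : ℂ) with hg
  have hgb : ∀ θ, g (bd θ) = (u θ : ℂ) := fun θ => by rw [hg]; simp only [bd_arg]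
  have hci : CircleIntegrable g 0 1 := by
    unfold CircleIntegrable
    simp_rw [← bd_coe, hgb]
    have hv : Integrable (fun θ : Tc => (u θ : ℂ)) volume := by
      rw [AddCircle.volume_eq_smul_haarAddCircle]
      exact (hu.ofReal).smul_measure ENNReal.ofReal_ne_top
    have := (AddCircle.measurePreserving_mk (2 * Real.pi) 0).integrable_comp_of_integrable hv
    rw [zero_add] at this
    rw [intervalIntegrable_iff_integrableOn_Ioc_of_le (by positivity)]
    exact this
  have h := differentiableOn_circleAverage_herglotzRieszKernel_smul hci
  refine h.congr fun z _ => ?_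
  rw [← integral_m_bd, HI]
  congr 1; ext θ
  rw [hgb]; simp [herglotzRieszKernel]

/-! ### `L¹` convergence of Poisson integrals -/

lemma continuous_Pk_uncurry {r : ℝ} (h0 : 0 ≤ r) (h1 : r < 1) :
    Continuous (fun p : Tc × Tc => Pk (r * bd p.1) p.2) := by
  unfold Pk
  have := continuous_bd
  apply Continuous.div (by fun_prop) (by fun_prop)
  intro p
  have := sub_ne (z := r * bd p.1) (by rw [norm_r_bd h0]; exact h1) p.2
  positivity

lemma aesm_PI {u : Tc → ℂ} (hu : Integrable u m) {r : ℝ} (h0 : 0 ≤ r) (h1 : r < 1) :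
    AEStronglyMeasurable (fun θ => PI u (r * bd θ)) m := by
  unfold PI
  have h : AEStronglyMeasurable (fun p : Tc × Tc => (Pk (r * bd p.1) p.2 : ℂ) * u p.2)
      (m.prod m) := by
    apply AEStronglyMeasurable.mul
    · exact (Complex.continuous_ofReal.comp (continuous_Pk_uncurry h0 h1)).aestronglyMeasurable
    · exact hu.aestronglyMeasurable.comp_snd
  exact h.integral_prod_right'

lemma lintegral_Pk {z : ℂ} (hz : ‖z‖ < 1) : ∫⁻ θ, ENNReal.ofReal (Pk z θ) ∂m = 1 := by
  have hi : Integrable (Pk z) m := by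
    simpa using integrable_Pk_mul_real (u := fun _ => 1) (integrable_const _) hz
  rw [← ofReal_integral_eq_lintegral_ofReal hi (Filter.Eventually.of_forall (Pk_nonneg hz)),
    integral_Pk hz]
  simp

lemma PI_contract {u : Tc → ℂ} (hu : Integrable u m) {r : ℝ} (h0 : 0 ≤ r) (h1 : r < 1) :
    ∫⁻ θ, ‖PI u (r * bd θ)‖ₑ ∂m ≤ ∫⁻ θ, ‖u θ‖ₑ ∂m := by
  have hz : ∀ θ, ‖(r : ℂ) * bd θ‖ < 1 := fun θ => by rw [norm_r_bd h0]; exact h1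
  calc ∫⁻ θ, ‖PI u (r * bd θ)‖ₑ ∂m
      ≤ ∫⁻ θ, ∫⁻ φ, ENNReal.ofReal (Pk (r * bd θ) φ) * ‖u φ‖ₑ ∂m ∂m := by
        apply lintegral_mono
        intro θ
        refine (enorm_integral_le_lintegral_enorm _).trans (le_of_eq ?_)
        congr 1; ext φ
        rw [enorm_mul]
        congr 1
        rw [← ofReal_norm, Complex.norm_real, Real.norm_of_nonneg (Pk_nonneg (hz θ) φ)]
    _ = ∫⁻ φ, ∫⁻ θ, ENNReal.ofReal (Pk (r * bd θ) φ) * ‖u φ‖ₑ ∂m ∂m := by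
        apply lintegral_lintegral_swap
        refine AEMeasurable.mul (f := fun p : Tc × Tc => ENNReal.ofReal (Pk (r * bd p.1) p.2))
          (g := fun p : Tc × Tc => ‖u p.2‖ₑ) ?_ ?_
        · exact (ENNReal.continuous_ofReal.comp (continuous_Pk_uncurry h0 h1)).measurable.aemeasurable
        · exact hu.aestronglyMeasurable.comp_snd.enorm
    _ = ∫⁻ φ, ‖u φ‖ₑ ∂m := by
        congr 1; ext φ
        rw [lintegral_mul_const'' _ ?_]
        · simp_rw [Pk_symm r _ φ]
          rw [lintegral_Pk (hz φ), one_mul]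
        · simp_rw [Pk_symm r _ φ]
          exact (ENNReal.continuous_ofReal.comp (continuous_Pk (hz φ))).measurable.aemeasurable

lemma PI_add {u v : Tc → ℂ} (hu : Integrable u m) (hv : Integrable v m) {z : ℂ} (hz : ‖z‖ < 1) :
    PI (fun θ => u θ + v θ) z = PI u z + PI v z := by
  unfold PI
  rw [← integral_add (integrable_Pk_mul hu hz) (integrable_Pk_mul hv hz)]
  simp_rw [mul_add]

lemma PI_smul (c : ℂ) (u : Tc → ℂ) (z : ℂ) :
    PI (fun θ => c * u θ) z = c * PI u z := by
  unfold PI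
  rw [← integral_const_mul]
  congr 1; ext θ; ring

lemma PI_sub {u v : Tc → ℂ} (hu : Integrable u m) (hv : Integrable v m) {z : ℂ} (hz : ‖z‖ < 1) :
    PI (fun θ => u θ - v θ) z = PI u z - PI v z := by
  unfold PI
  rw [← integral_sub (integrable_Pk_mul hu hz) (integrable_Pk_mul hv hz)]
  simp_rw [mul_sub]

/-- `L¹` convergence of the Poisson integrals of `u` to `u`. -/
def TT (u : Tc → ℂ) : Prop :=
  Tendsto (fun r : ℝ => ∫⁻ θ, ‖PI u (r * bd θ) - u θ‖ₑ ∂m) (nhdsWithin 1 (Set.Iio 1)) (nhds 0)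

lemma TT_congr {u v : Tc → ℂ} (h : u =ᵐ[m] v) (hu : TT u) : TT v := by
  unfold TT at *
  refine hu.congr fun r => ?_
  have hP : ∀ z, PI u z = PI v z := fun z => by
    unfold PI
    apply integral_congr_ae
    filter_upwards [h] with θ hθ
    rw [hθ]
  apply lintegral_congr_ae
  filter_upwards [h] with θ hθ
  rw [hθ, hP]

lemma ev_r : ∀ᶠ r : ℝ in nhdsWithin 1 (Set.Iio 1), 0 ≤ r ∧ r < 1 := by
  have h1 : ∀ᶠ r : ℝ in nhdsWithin 1 (Set.Iio 1), r < 1 := self_mem_nhdsWithin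
  have h2 : ∀ᶠ r : ℝ in nhdsWithin 1 (Set.Iio 1), 0 < r :=
    mem_nhdsWithin_of_mem_nhds (Ioi_mem_nhds (by norm_num))
  filter_upwards [h1, h2] with r a b using ⟨b.le, a⟩

lemma TT_add {u v : Tc → ℂ} (hu : Integrable u m) (hv : Integrable v m) (h1 : TT u) (h2 : TT v) :
    TT (fun θ => u θ + v θ) := by
  have h := h1.add h2
  rw [add_zero] at h
  refine tendsto_of_tendsto_of_tendsto_of_le_of_le' tendsto_const_nhds h
    (Filter.Eventually.of_forall fun _ => zero_le) ?_
  filter_upwards [ev_r] with r hr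
  have hm : AEMeasurable (fun θ => ‖PI u (r * bd θ) - u θ‖ₑ) m :=
    ((aesm_PI hu hr.1 hr.2).sub hu.aestronglyMeasurable).enorm
  rw [← lintegral_add_left' hm]
  apply lintegral_mono
  intro θ
  dsimp only
  rw [PI_add hu hv (by rw [norm_r_bd hr.1]; exact hr.2)]
  refine le_trans (le_of_eq ?_) (enorm_add_le _ _)
  congr 1; ring

lemma TT_smul {u : Tc → ℂ} (c : ℂ) (h1 : TT u) : TT (fun θ => c * u θ) := by
  unfold TT
  have h := ENNReal.Tendsto.const_mul (a := ‖c‖ₑ) h1 (Or.inr enorm_ne_top)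
  rw [mul_zero] at h
  refine h.congr fun r => ?_
  rw [← lintegral_const_mul' _ _ enorm_ne_top]
  congr 1; ext θ
  rw [PI_smul, ← mul_sub, enorm_mul]

lemma PI_pow (n : ℕ) {z : ℂ} (hz : ‖z‖ < 1) : PI (fun θ => bd θ ^ n) z = z ^ n :=
  poisson_formula hz (f := fun z => z ^ n) (Differentiable.diffContOnCl (by fun_prop))

lemma PI_conj (u : Tc → ℂ) (z : ℂ) : PI (fun θ => conj (u θ)) z = conj (PI u z) := by
  unfold PI
  rw [← integral_conj]
  congr 1; ext θ; simp

lemma TT_pow (n : ℕ) : TT (fun θ => bd θ ^ n) := by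
  unfold TT
  have h : Tendsto (fun r : ℝ => ‖(r : ℂ) ^ n - 1‖ₑ) (nhdsWithin 1 (Set.Iio 1)) (nhds 0) := by
    have : Continuous (fun r : ℝ => ‖(r : ℂ) ^ n - 1‖ₑ) := by fun_prop
    have h2 := (this.tendsto 1).mono_left (nhdsWithin_le_nhds (s := Set.Iio 1))
    simpa using h2
  refine h.congr' ?_
  filter_upwards [ev_r] with r hr
  have : ∀ θ, ‖PI (fun θ => bd θ ^ n) (r * bd θ) - bd θ ^ n‖ₑ = ‖(r : ℂ) ^ n - 1‖ₑ := by
    intro θ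
    rw [PI_pow n (by rw [norm_r_bd hr.1]; exact hr.2), mul_pow]
    have e : (r : ℂ) ^ n * bd θ ^ n - bd θ ^ n = ((r : ℂ) ^ n - 1) * bd θ ^ n := by ring
    rw [e, enorm_mul, ← ofReal_norm (bd θ ^ n), norm_pow, norm_bd]
    simp
  simp_rw [this]
  simp

lemma TT_conj {u : Tc → ℂ} (h : TT u) : TT (fun θ => conj (u θ)) := by
  unfold TT
  refine h.congr fun r => ?_
  congr 1; ext θ
  rw [PI_conj, ← map_sub, ← ofReal_norm, ← ofReal_norm, Complex.norm_conj]

lemma TT_fourier (n : ℤ) : TT (fun θ => fourier n θ) := by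
  obtain ⟨k, rfl | rfl⟩ := n.eq_nat_or_neg
  · have : (fun θ : Tc => fourier (k : ℤ) θ) = fun θ => bd θ ^ k := by
      ext θ
      rw [fourier_apply, AddCircle.toCircle_zsmul, zpow_natCast]; rfl
    rw [this]; exact TT_pow k
  · have : (fun θ : Tc => fourier (-(k : ℤ)) θ) = fun θ => conj (bd θ ^ k) := by
      ext θ
      rw [fourier_neg, fourier_apply, AddCircle.toCircle_zsmul, zpow_natCast]; rfl
    rw [this]; exact TT_conj (TT_pow k)

lemma TT_dense {u : Tc → ℂ} (hu : Integrable u m) {ε : ℝ} (hε : 0 < ε) :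
    ∃ p : Tc → ℂ, Integrable p m ∧ TT p ∧ ∫⁻ θ, ‖u θ - p θ‖ₑ ∂m ≤ ENNReal.ofReal ε := by
  have hu' : MemLp u 1 (AddCircle.haarAddCircle (T := 2 * Real.pi)) :=
    memLp_one_iff_integrable.mpr hu
  set U := hu'.toLp u with hU
  have hmem : U ∈ (Submodule.span ℂ (range (fourierLp (T := 2 * Real.pi) 1))).topologicalClosure := by
    rw [span_fourierLp_closure_eq_top (by simp)]; trivial
  obtain ⟨p, hp, hd⟩ := Metric.mem_closure_iff.mp hmem ε hε
  refine ⟨p, L1.integrable_coeFn p, ?_, ?_⟩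
  · have hp' : p ∈ Submodule.span ℂ (range (fourierLp (T := 2 * Real.pi) 1)) := hp
    refine Submodule.span_induction
      (p := fun (x : Lp ℂ 1 (AddCircle.haarAddCircle (T := 2 * Real.pi))) _ => TT (x : Tc → ℂ))
      ?_ ?_ ?_ ?_ hp'
    · rintro x ⟨n, rfl⟩
      exact TT_congr (coeFn_fourierLp 1 n).symm (TT_fourier n)
    · refine TT_congr (Lp.coeFn_zero ℂ 1 _).symm ?_
      have h0 := TT_smul (0 : ℂ) (TT_pow 0)
      simp only [zero_mul] at h0
      exact h0
    · intro x y _ _ hx hy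
      exact TT_congr (Lp.coeFn_add x y).symm
        (TT_add (L1.integrable_coeFn x) (L1.integrable_coeFn y) hx hy)
    · intro a x _ hx
      exact TT_congr (Lp.coeFn_smul a x).symm (TT_smul a hx)
  · have h1 : edist U p ≤ ENNReal.ofReal ε := by
      rw [edist_dist]; exact ENNReal.ofReal_le_ofReal hd.le
    rw [Lp.edist_def, eLpNorm_one_eq_lintegral_enorm] at h1
    refine le_trans (le_of_eq ?_) h1
    apply lintegral_congr_ae
    filter_upwards [hu'.coeFn_toLp] with θ hθ
    simp only [Pi.sub_apply]
    rw [hU, hθ]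

lemma TT_all {u : Tc → ℂ} (hu : Integrable u m) : TT u := by
  unfold TT
  rw [ENNReal.tendsto_nhds_zero]
  intro ε hε
  obtain ⟨δ, hδ0, hδ⟩ : ∃ δ : ℝ, 0 < δ ∧ ENNReal.ofReal δ ≤ ε / 3 := by
    rcases eq_or_ne ε ⊤ with rfl | hε'
    · exact ⟨1, one_pos, by simp [ENNReal.top_div]⟩
    · refine ⟨(ε / 3).toReal, ENNReal.toReal_pos ?_ ?_, ENNReal.ofReal_toReal_le⟩
      · exact (ENNReal.div_pos hε.ne' (by simp)).ne'
      · exact ENNReal.div_ne_top hε' (by simp)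
  obtain ⟨p, hp, hT, hd⟩ := TT_dense hu hδ0
  have hT' := (ENNReal.tendsto_nhds_zero.mp hT) (ε / 3)
    (ENNReal.div_pos hε.ne' (by simp))
  filter_upwards [ev_r, hT'] with r hr hr2
  have hup : Integrable (fun θ => u θ - p θ) m := hu.sub hp
  have hz : ∀ θ, ‖(r : ℂ) * bd θ‖ < 1 := fun θ => by rw [norm_r_bd hr.1]; exact hr.2
  calc ∫⁻ θ, ‖PI u (r * bd θ) - u θ‖ₑ ∂m
      ≤ ∫⁻ θ, (‖PI (fun θ => u θ - p θ) (r * bd θ)‖ₑ + ‖PI p (r * bd θ) - p θ‖ₑ)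
          + ‖u θ - p θ‖ₑ ∂m := by
        apply lintegral_mono
        intro θ
        dsimp only
        have e : PI u (r * bd θ) - u θ = (PI (fun θ => u θ - p θ) (r * bd θ)
          + (PI p (r * bd θ) - p θ)) - (u θ - p θ) := by
          rw [PI_sub hu hp (hz θ)]; ring
        rw [e]
        refine (enorm_sub_le).trans ?_
        gcongr
        exact enorm_add_le _ _
    _ = (∫⁻ θ, ‖PI (fun θ => u θ - p θ) (r * bd θ)‖ₑ ∂m + ∫⁻ θ, ‖PI p (r * bd θ) - p θ‖ₑ ∂m)
          + ∫⁻ θ, ‖u θ - p θ‖ₑ ∂m := by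
        rw [lintegral_add_right' _ hup.aestronglyMeasurable.enorm,
          lintegral_add_left' (aesm_PI hup hr.1 hr.2).enorm]
    _ ≤ (ε / 3 + ε / 3) + ε / 3 := by
        gcongr
        · exact (PI_contract hup hr.1 hr.2).trans (hd.trans hδ)
        · exact hd.trans hδ
    _ = ε := ENNReal.add_thirds ε

/-- Sequential a.e. convergence of Poisson integrals. -/
lemma exists_seq_one {u : Tc → ℝ} (hu : Integrable u m) (s : ℕ → ℝ) (hs : ∀ n, 0 ≤ s n ∧ s n < 1)
    (hs1 : Tendsto s atTop (nhds 1)) :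
    ∃ ns : ℕ → ℕ, StrictMono ns ∧ ∀ᵐ θ ∂m,
      Tendsto (fun n => ∫ φ, Pk (s (ns n) * bd θ) φ * u φ ∂m) atTop (nhds (u θ)) := by
  have hT := TT_all (u := fun θ => (u θ : ℂ)) hu.ofReal
  have hs2 : Tendsto s atTop (nhdsWithin 1 (Set.Iio 1)) :=
    tendsto_nhdsWithin_iff.mpr ⟨hs1, Filter.Eventually.of_forall fun n => (hs n).2⟩
  have h := hT.comp hs2
  have hm : TendstoInMeasure m (fun n θ => PI (fun θ => (u θ : ℂ)) (s n * bd θ)) atTop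
      (fun θ => (u θ : ℂ)) := by
    apply tendstoInMeasure_of_tendsto_eLpNorm (p := 1) one_ne_zero
    · intro n; exact aesm_PI hu.ofReal (hs n).1 (hs n).2
    · exact hu.ofReal.aestronglyMeasurable
    · simp_rw [eLpNorm_one_eq_lintegral_enorm]
      exact h
  obtain ⟨ns, hns, hae⟩ := hm.exists_seq_tendsto_ae
  refine ⟨ns, hns, ?_⟩
  filter_upwards [hae] with θ hθ
  simp_rw [PI_ofReal] at hθ
  have := (Complex.continuous_re.tendsto _).comp hθ
  simpa [Function.comp_def] using this

lemma exists_seq {u v : Tc → ℝ} (hu : Integrable u m) (hv : Integrable v m) :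
    ∃ s : ℕ → ℝ, (∀ n, 0 ≤ s n ∧ s n < 1) ∧ Tendsto s atTop (nhds 1) ∧
      (∀ᵐ θ ∂m, Tendsto (fun n => ∫ φ, Pk (s n * bd θ) φ * u φ ∂m) atTop (nhds (u θ))) ∧
      (∀ᵐ θ ∂m, Tendsto (fun n => ∫ φ, Pk (s n * bd θ) φ * v φ ∂m) atTop (nhds (v θ))) := by
  set s : ℕ → ℝ := fun n => 1 - 1 / ((n : ℝ) + 1) with hs
  have h1 : ∀ n, 0 ≤ s n ∧ s n < 1 := fun n => by
    have hp : (0 : ℝ) < (n : ℝ) + 1 := by positivity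
    have h2 : 1 / ((n : ℝ) + 1) ≤ 1 := by
      rw [div_le_one hp]; linarith [Nat.cast_nonneg (α := ℝ) n]
    have h3 : 0 < 1 / ((n : ℝ) + 1) := by positivity
    simp only [hs]
    constructor <;> linarith
  have h2 : Tendsto s atTop (nhds 1) := by
    have := (tendsto_one_div_add_atTop_nhds_zero_nat (𝕜 := ℝ)).const_sub 1
    simpa [hs] using this
  obtain ⟨a, ha, hA⟩ := exists_seq_one hu s h1 h2
  obtain ⟨b, hb, hB⟩ := exists_seq_one hv (fun n => s (a n)) (fun n => h1 _)
    (h2.comp ha.tendsto_atTop)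
  refine ⟨fun n => s (a (b n)), fun n => h1 _,
    h2.comp (ha.tendsto_atTop.comp hb.tendsto_atTop), ?_, hB⟩
  filter_upwards [hA] with θ hθ
  exact hθ.comp hb.tendsto_atTop

/-! ### A Smirnov type maximum principle -/

lemma smirnov_trunc {k : ℂ → ℂ} (hk : DifferentiableOn ℂ k (ball 0 1)) {C : ℝ}
    (hC : ∀ z ∈ ball (0 : ℂ) 1, ‖k z‖ ≤ C) {u U : Tc → ℝ} (hu : Integrable u m)
    (hU : Integrable U m)
    (hlim : ∀ᵐ θ ∂m, ∀ s : ℕ → ℝ, (∀ n, 0 ≤ s n ∧ s n < 1) → Tendsto s atTop (nhds 1) →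
      Tendsto (fun n => ∫ φ, Pk (s n * bd θ) φ * u φ ∂m) atTop (nhds (u θ)) →
      Tendsto (fun n => ‖k (s n * bd θ)‖) atTop (nhds (Real.exp (U θ))))
    {z : ℂ} (hz : ‖z‖ < 1) (N : ℕ) :
    ‖k z‖ ≤ Real.exp (∫ θ, Pk z θ * max (U θ) (-(N : ℝ)) ∂m) := by
  set UN : Tc → ℝ := fun θ => max (U θ) (-(N : ℝ)) with hUN
  have hUNi : Integrable UN m := hU.sup (integrable_const _)
  obtain ⟨s, hs, hs1, hsu, hsU⟩ := exists_seq hu hUNi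
  set q : ℂ → ℂ := fun ζ => k ζ * Complex.exp (-HI UN ζ) with hq
  have hqd : DifferentiableOn ℂ q (ball 0 1) := by
    have := HI_differentiableOn hUNi
    exact hk.mul (this.neg.cexp)
  have hqn : ∀ ζ : ℂ, ‖ζ‖ < 1 → ‖q ζ‖ = ‖k ζ‖ * Real.exp (-∫ θ, Pk ζ θ * UN θ ∂m) := by
    intro ζ hζ
    simp only [hq, norm_mul, Complex.norm_exp, Complex.neg_re, HI_re hUNi hζ]
  have hlow : ∀ ζ : ℂ, ‖ζ‖ < 1 → -(N : ℝ) ≤ ∫ θ, Pk ζ θ * UN θ ∂m := by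
    intro ζ hζ
    have h1 : ∫ θ, Pk ζ θ * (-(N : ℝ)) ∂m = -(N : ℝ) := by
      rw [integral_mul_const, integral_Pk hζ, one_mul]
    rw [← h1]
    apply integral_mono (integrable_Pk_mul_real (integrable_const _) hζ)
      (integrable_Pk_mul_real hUNi hζ)
    intro θ
    exact mul_le_mul_of_nonneg_left (le_max_right _ _) (Pk_nonneg hζ θ)
  have hC0 : 0 ≤ C := (norm_nonneg _).trans (hC 0 (by simp))
  have hqb : ∀ ζ : ℂ, ‖ζ‖ < 1 → ‖q ζ‖ ≤ C * Real.exp N := by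
    intro ζ hζ
    rw [hqn ζ hζ]
    apply mul_le_mul (hC ζ (by simpa using hζ)) _ (Real.exp_pos _).le hC0
    apply Real.exp_le_exp.mpr
    linarith [hlow ζ hζ]
  have hsz : ∀ n θ, ‖(s n : ℂ) * bd θ‖ < 1 := fun n θ => by
    rw [norm_r_bd (hs n).1]; exact (hs n).2
  have hmaps : ∀ n, MapsTo (fun ζ : ℂ => (s n : ℂ) * ζ) (closedBall 0 1) (ball 0 1) := by
    intro n ζ hζ
    simp only [mem_closedBall, dist_zero_right] at hζ
    simp only [mem_ball, dist_zero_right, norm_mul, Complex.norm_real,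
      Real.norm_of_nonneg (hs n).1]
    calc s n * ‖ζ‖ ≤ s n * 1 := mul_le_mul_of_nonneg_left hζ (hs n).1
      _ < 1 := by linarith [(hs n).2]
  have hdc : ∀ n, DifferentiableOn ℂ (fun ζ => q (s n * ζ)) (closedBall 0 1) := fun n =>
    hqd.comp (by fun_prop) (hmaps n)
  have hcont : ∀ n, Continuous (fun θ => q (s n * bd θ)) := fun n =>
    (hdc n).continuousOn.comp_continuous continuous_bd (fun θ => by simp)
  have hineq : ∀ n, ‖q (s n * z)‖ ≤ ∫ θ, Pk z θ * ‖q (s n * bd θ)‖ ∂m := by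
    intro n
    have hd : DiffContOnCl ℂ (fun ζ => q (s n * ζ)) (ball 0 1) :=
      ((hdc n).mono closure_ball_subset_closedBall).diffContOnCl
    have h := poisson_formula hz hd
    rw [← h]
    refine (norm_integral_le_integral_norm _).trans (le_of_eq ?_)
    congr 1; ext θ
    rw [norm_mul, Complex.norm_real, Real.norm_of_nonneg (Pk_nonneg hz θ)]
  have hL : Tendsto (fun n => ‖q (s n * z)‖) atTop (nhds ‖q z‖) := by
    have hzb : z ∈ ball (0 : ℂ) 1 := by simpa using hz
    have h1 : ContinuousAt q z := (hqd.differentiableAt (isOpen_ball.mem_nhds hzb)).continuousAt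
    have h2 : Tendsto (fun n => (s n : ℂ) * z) atTop (nhds z) := by
      have := ((Complex.continuous_ofReal.tendsto 1).comp hs1).mul_const z
      simpa using this
    exact (h1.tendsto.comp h2).norm
  have hR : Tendsto (fun n => ∫ θ, Pk z θ * ‖q (s n * bd θ)‖ ∂m) atTop
      (nhds (∫ θ, Pk z θ * Real.exp (U θ - UN θ) ∂m)) := by
    apply tendsto_integral_of_dominated_convergence (fun θ => Pk z θ * (C * Real.exp N))
    · intro n
      exact ((continuous_Pk hz).mul (hcont n).norm).aestronglyMeasurable
    · exact integrable_Pk_mul_real (integrable_const _) hz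
    · intro n
      filter_upwards with θ
      rw [Real.norm_of_nonneg (mul_nonneg (Pk_nonneg hz θ) (norm_nonneg _))]
      exact mul_le_mul_of_nonneg_left (hqb _ (hsz n θ)) (Pk_nonneg hz θ)
    · filter_upwards [hlim, hsu, hsU] with θ h1 h2 h3
      apply Tendsto.const_mul
      have h4 := h1 s hs hs1 h2
      simp_rw [fun n => hqn _ (hsz n θ)]
      rw [sub_eq_add_neg, Real.exp_add]
      exact h4.mul ((Real.continuous_exp.tendsto _).comp h3.neg)
  have hq1 : ‖q z‖ ≤ 1 := by
    refine (le_of_tendsto_of_tendsto' hL hR hineq).trans ?_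
    by_cases hi : Integrable (fun θ => Pk z θ * Real.exp (U θ - UN θ)) m
    · rw [← integral_Pk hz]
      have hPi : Integrable (Pk z) m := by
        simpa using integrable_Pk_mul_real (u := fun _ => 1) (integrable_const _) hz
      apply integral_mono hi hPi
      intro θ
      have : Real.exp (U θ - UN θ) ≤ 1 := by
        rw [Real.exp_le_one_iff]
        have := le_max_left (U θ) (-(N : ℝ))
        simp only [hUN]; linarith
      calc Pk z θ * Real.exp (U θ - UN θ) ≤ Pk z θ * 1 :=
            mul_le_mul_of_nonneg_left this (Pk_nonneg hz θ)
        _ = Pk z θ := mul_one _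
    · rw [integral_undef hi]; norm_num
  rw [hqn z hz, Real.exp_neg] at hq1
  have := mul_inv_le_iff₀ (Real.exp_pos (∫ θ, Pk z θ * UN θ ∂m)) |>.mp hq1
  linarith

lemma smirnov_max {k : ℂ → ℂ} (hk : DifferentiableOn ℂ k (ball 0 1)) {C : ℝ}
    (hC : ∀ z ∈ ball (0 : ℂ) 1, ‖k z‖ ≤ C) {u U : Tc → ℝ} (hu : Integrable u m)
    (hU : Integrable U m)
    (hlim : ∀ᵐ θ ∂m, ∀ s : ℕ → ℝ, (∀ n, 0 ≤ s n ∧ s n < 1) → Tendsto s atTop (nhds 1) →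
      Tendsto (fun n => ∫ φ, Pk (s n * bd θ) φ * u φ ∂m) atTop (nhds (u θ)) →
      Tendsto (fun n => ‖k (s n * bd θ)‖) atTop (nhds (Real.exp (U θ))))
    {z : ℂ} (hz : ‖z‖ < 1) :
    ‖k z‖ ≤ Real.exp (∫ θ, Pk z θ * U θ ∂m) := by
  have hT : Tendsto (fun N : ℕ => ∫ θ, Pk z θ * max (U θ) (-(N : ℝ)) ∂m) atTop
      (nhds (∫ θ, Pk z θ * U θ ∂m)) := by
    apply tendsto_integral_of_dominated_convergence (fun θ => Pk z θ * |U θ|)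
    · intro N
      exact (integrable_Pk_mul_real (hU.sup (integrable_const _)) hz).aestronglyMeasurable
    · exact integrable_Pk_mul_real hU.abs hz
    · intro N
      filter_upwards with θ
      rw [norm_mul, Real.norm_of_nonneg (Pk_nonneg hz θ), Real.norm_eq_abs]
      apply mul_le_mul_of_nonneg_left _ (Pk_nonneg hz θ)
      have hN : (0 : ℝ) ≤ N := Nat.cast_nonneg N
      rcases le_total (U θ) (-(N : ℝ)) with h | h
      · rw [max_eq_right h, abs_of_nonpos (by linarith), abs_of_nonpos (by linarith)]
        linarith
      · rw [max_eq_left h]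
    · filter_upwards with θ
      apply Tendsto.const_mul
      apply tendsto_const_nhds.congr'
      obtain ⟨M, hM⟩ := exists_nat_ge (-U θ)
      filter_upwards [Filter.eventually_ge_atTop M] with N hN
      rw [max_eq_left]
      have : (M : ℝ) ≤ N := by exact_mod_cast hN
      linarith
  exact ge_of_tendsto' ((Real.continuous_exp.tendsto _).comp hT)
    (fun N => smirnov_trunc hk hC hu hU hlim hz N)

/-! ### The weak-type estimate -/

lemma lintegral_inv_sq {t : ℝ} (ht : 0 < t) :
    ∫⁻ s in Ioi (0 : ℝ), ENNReal.ofReal (1 / (t ^ 2 + s ^ 2))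
      = ENNReal.ofReal (Real.pi / 2 / t) := by
  have hder : ∀ x ∈ Ici (0 : ℝ),
      HasDerivAt (fun s : ℝ => Real.arctan (s / t) / t) (1 / (t ^ 2 + x ^ 2)) x := by
    intro x _
    have h1 : HasDerivAt (fun s : ℝ => s / t) (1 / t) x := (hasDerivAt_id x).div_const t
    have h2 := (h1.arctan).div_const t
    refine HasDerivAt.congr_deriv h2 ?_
    have : t ^ 2 + x ^ 2 ≠ 0 := by positivity
    have : 1 + (x / t) ^ 2 ≠ 0 := by positivity
    field_simp
  have hpos : ∀ x ∈ Ioi (0 : ℝ), 0 ≤ 1 / (t ^ 2 + x ^ 2) := fun x _ => by positivity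
  have hlim : Tendsto (fun s : ℝ => Real.arctan (s / t) / t) atTop
      (nhds (Real.pi / 2 / t)) := by
    have h1 : Tendsto (fun s : ℝ => s / t) atTop atTop := tendsto_id.atTop_div_const ht
    have h2 := (Real.tendsto_arctan_atTop.mono_right nhdsWithin_le_nhds).comp h1
    exact h2.div_const t
  have hi := integrableOn_Ioi_deriv_of_nonneg' hder hpos hlim
  have hv := integral_Ioi_of_hasDerivAt_of_nonneg' hder hpos hlim
  rw [← ofReal_integral_eq_lintegral_ofReal hi
    (Filter.Eventually.of_forall fun x => by positivity), hv]
  simp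

/-- The logarithmic majorant. -/
def vt (a : Tc → ℝ) (t : ℝ) (θ : Tc) : ℝ := Real.log (1 + (a θ / t) ^ 2) / 2

lemma vt_nonneg (a : Tc → ℝ) (t : ℝ) (θ : Tc) : 0 ≤ vt a t θ := by
  unfold vt
  have : 0 ≤ Real.log (1 + (a θ / t) ^ 2) := Real.log_nonneg (by nlinarith [sq_nonneg (a θ / t)])
  linarith

lemma vt_eq (a : Tc → ℝ) {t : ℝ} (ht : 0 < t) (θ : Tc) :
    ∫ s in (0 : ℝ)..|a θ|, s / (t ^ 2 + s ^ 2) = vt a t θ := by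
  have hder : ∀ x ∈ uIcc (0 : ℝ) |a θ|,
      HasDerivAt (fun s : ℝ => Real.log (1 + (s / t) ^ 2) / 2) (x / (t ^ 2 + x ^ 2)) x := by
    intro x _
    have h1 : HasDerivAt (fun s : ℝ => s / t) (1 / t) x := (hasDerivAt_id x).div_const t
    have h3 : (1 + (x / t) ^ 2) ≠ 0 := by positivity
    have h2 := (((h1.pow 2).const_add 1).log h3).div_const 2
    refine HasDerivAt.congr_deriv h2 ?_
    have : t ^ 2 + x ^ 2 ≠ 0 := by positivity
    simp
    field_simp
  rw [intervalIntegral.integral_eq_sub_of_hasDerivAt hder]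
  · simp [vt, div_pow]
  · apply Continuous.intervalIntegrable
    exact Continuous.div (by fun_prop) (by fun_prop) (fun s => by positivity)

lemma weak_bound {a : Tc → ℝ} (ha : AEMeasurable a m) {ε S : ℝ} (hε : 0 ≤ ε) (hS : 0 < S)
    (hA : ∀ s, S ≤ s → s * (m {θ | s < |a θ|}).toReal ≤ ε) {t : ℝ} (ht : 0 < t) :
    ∫⁻ θ, ENNReal.ofReal (vt a t θ) ∂m
      ≤ ENNReal.ofReal ((ε * (Real.pi / 2) + Real.pi * S ^ 2 / t) / t) := by
  have hg0 : ∀ s : ℝ, t ^ 2 + s ^ 2 ≠ 0 := fun s => by positivity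
  have hlc := lintegral_comp_eq_lintegral_meas_lt_mul (f := fun θ => |a θ|)
    (g := fun s => s / (t ^ 2 + s ^ 2)) m
    (Filter.Eventually.of_forall fun θ => abs_nonneg _) ha.norm
    (fun s _ => (Continuous.div (by fun_prop) (by fun_prop) hg0).intervalIntegrable _ _)
    (by
      rw [ae_restrict_iff' measurableSet_Ioi]
      filter_upwards with s hs
      have : 0 < s := hs
      positivity)
  simp_rw [vt_eq a ht] at hlc
  rw [hlc]
  calc ∫⁻ s in Ioi (0 : ℝ), m {θ | s < |a θ|} * ENNReal.ofReal (s / (t ^ 2 + s ^ 2))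
      ≤ ∫⁻ s in Ioi (0 : ℝ), (ENNReal.ofReal ε * ENNReal.ofReal (1 / (t ^ 2 + s ^ 2))
          + ENNReal.ofReal (2 * S ^ 3 / t ^ 2) * ENNReal.ofReal (1 / (S ^ 2 + s ^ 2))) := by
        apply setLIntegral_mono' measurableSet_Ioi
        intro s hs
        have hs0 : 0 < s := hs
        set A := (m {θ | s < |a θ|}).toReal with hAdef
        have hA1 : A ≤ 1 := by
          have := prob_le_one (μ := m) (s := {θ | s < |a θ|})
          exact ENNReal.toReal_le_of_le_ofReal zero_le_one (by simpa using this)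
        have hA0 : 0 ≤ A := ENNReal.toReal_nonneg
        have hm : m {θ | s < |a θ|} = ENNReal.ofReal A :=
          (ENNReal.ofReal_toReal (measure_ne_top _ _)).symm
        rw [hm, ← ENNReal.ofReal_mul hA0, ← ENNReal.ofReal_mul hε,
          ← ENNReal.ofReal_mul (by positivity), ← ENNReal.ofReal_add (by positivity) (by positivity)]
        apply ENNReal.ofReal_le_ofReal
        rcases le_total S s with h | h
        · have h1 := hA s h
          have h2 : A * (s / (t ^ 2 + s ^ 2)) ≤ ε * (1 / (t ^ 2 + s ^ 2)) := by
            rw [mul_one_div, ← mul_div_assoc]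
            apply div_le_div_of_nonneg_right _ (by positivity)
            linarith
          have h3 : 0 ≤ 2 * S ^ 3 / t ^ 2 * (1 / (S ^ 2 + s ^ 2)) := by positivity
          linarith
        · have h2 : A * (s / (t ^ 2 + s ^ 2)) ≤ S / t ^ 2 := by
            calc A * (s / (t ^ 2 + s ^ 2)) ≤ 1 * (s / (t ^ 2 + s ^ 2)) :=
                  mul_le_mul_of_nonneg_right hA1 (by positivity)
              _ ≤ S / t ^ 2 := by
                  rw [one_mul]
                  apply div_le_div₀ hS.le h (by positivity)
                  nlinarith
          have h3 : S / t ^ 2 ≤ 2 * S ^ 3 / t ^ 2 * (1 / (S ^ 2 + s ^ 2)) := by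
            have e : 2 * S ^ 3 / t ^ 2 * (1 / (S ^ 2 + s ^ 2))
              = S / t ^ 2 * (2 * S ^ 2 / (S ^ 2 + s ^ 2)) := by ring
            rw [e]
            apply le_mul_of_one_le_right (by positivity)
            rw [one_le_div (by positivity)]
            nlinarith
          have h4 : 0 ≤ ε * (1 / (t ^ 2 + s ^ 2)) := by positivity
          linarith
    _ = ENNReal.ofReal ε * ENNReal.ofReal (Real.pi / 2 / t)
          + ENNReal.ofReal (2 * S ^ 3 / t ^ 2) * ENNReal.ofReal (Real.pi / 2 / S) := by
        have hm : ∀ t : ℝ, Measurable (fun s : ℝ => ENNReal.ofReal (1 / (t ^ 2 + s ^ 2))) :=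
          fun t => by fun_prop
        rw [lintegral_add_left ((hm t).const_mul _), lintegral_const_mul _ (hm t),
          lintegral_const_mul _ (hm S), lintegral_inv_sq ht, lintegral_inv_sq hS]
    _ ≤ _ := by
        rw [← ENNReal.ofReal_mul hε, ← ENNReal.ofReal_mul (by positivity),
          ← ENNReal.ofReal_add (by positivity) (by positivity)]
        apply ENNReal.ofReal_le_ofReal
        apply le_of_eq
        field_simp

lemma aesm_vt {a : Tc → ℝ} (ha : AEMeasurable a m) (t : ℝ) :
    AEStronglyMeasurable (vt a t) m := by
  apply AEMeasurable.aestronglyMeasurable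
  unfold vt
  have : Measurable (fun x : ℝ => Real.log (1 + (x / t) ^ 2) / 2) := by fun_prop
  exact this.comp_aemeasurable ha

/-- `L₀^{1,∞}` condition for real functions. -/
def Wk (a : Tc → ℝ) : Prop :=
  Tendsto (fun t : ℝ => t * (m {θ | t < |a θ|}).toReal) atTop (nhds 0)

lemma weak_S {a : Tc → ℝ} (hw : Wk a) {ε : ℝ} (hε : 0 < ε) :
    ∃ S : ℝ, 0 < S ∧ ∀ s, S ≤ s → s * (m {θ | s < |a θ|}).toReal ≤ ε := by
  have h := (hw.eventually (Iic_mem_nhds hε))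
  obtain ⟨S, hS⟩ := Filter.eventually_atTop.mp h
  exact ⟨max S 1, by positivity, fun s hs => hS s ((le_max_left _ _).trans hs)⟩

lemma integrable_vt {a : Tc → ℝ} (ha : AEMeasurable a m) (hw : Wk a) {t : ℝ} (ht : 0 < t) :
    Integrable (vt a t) m := by
  obtain ⟨S, hS, hA⟩ := weak_S hw one_pos
  refine ⟨aesm_vt ha t, ?_⟩
  rw [hasFiniteIntegral_iff_ofReal (Filter.Eventually.of_forall (vt_nonneg a t))]
  exact (weak_bound ha zero_le_one hS hA ht).trans_lt ENNReal.ofReal_lt_top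

lemma tendsto_vt {a : Tc → ℝ} (ha : AEMeasurable a m) (hw : Wk a) :
    Tendsto (fun t : ℝ => t * ∫ θ, vt a t θ ∂m) atTop (nhds 0) := by
  have hnn : ∀ t : ℝ, 0 ≤ ∫ θ, vt a t θ ∂m := fun t => integral_nonneg (vt_nonneg a t)
  rw [Metric.tendsto_atTop]
  intro δ hδ
  set ε := δ / 4 with hεd
  have hε : 0 < ε := by positivity
  obtain ⟨S, hS, hA⟩ := weak_S hw hε
  have hpi := Real.pi_pos
  have hpi4 := Real.pi_lt_four
  refine ⟨max 1 (4 * Real.pi * S ^ 2 / δ), fun t ht => ?_⟩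
  have ht0 : 0 < t := lt_of_lt_of_le one_pos ((le_max_left _ _).trans ht)
  have ht1 : 4 * Real.pi * S ^ 2 / δ ≤ t := (le_max_right _ _).trans ht
  have hb := weak_bound ha hε.le hS hA ht0
  rw [← ofReal_integral_eq_lintegral_ofReal (integrable_vt ha hw ht0)
    (Filter.Eventually.of_forall (vt_nonneg a t))] at hb
  have hb2 := (ENNReal.ofReal_le_ofReal_iff (by positivity)).mp hb
  rw [le_div_iff₀ ht0] at hb2
  rw [Real.dist_eq, sub_zero, abs_of_nonneg (mul_nonneg ht0.le (hnn t))]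
  have h3 : Real.pi * S ^ 2 / t ≤ δ / 4 := by
    rw [div_le_iff₀ hδ] at ht1
    rw [div_le_iff₀ ht0]
    linarith
  have h4 : ε * (Real.pi / 2) < δ / 2 := by
    rw [hεd]; nlinarith
  linarith

/-! ### Real boundary values -/

lemma im_nonneg_aux {G h : ℂ → ℂ} {γ u : Tc → ℝ} (hG : DifferentiableOn ℂ G (ball 0 1))
    (hh : DifferentiableOn ℂ h (ball 0 1)) {C₁ C₂ : ℝ} (hC₁ : ∀ z ∈ ball (0 : ℂ) 1, ‖h z‖ ≤ C₁)
    (hC₂ : ∀ z ∈ ball (0 : ℂ) 1, ‖h z * G z‖ ≤ C₂) (hu : Integrable u m)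
    (hhu : ∀ z : ℂ, ‖z‖ < 1 → ‖h z‖ = Real.exp (∫ θ, Pk z θ * u θ ∂m))
    (hbd : IsBdry G (fun θ => (γ θ : ℂ))) (hγ : AEMeasurable γ m) (hw : Wk γ)
    {σ : ℝ} (hσ : σ ^ 2 = 1) {z : ℂ} (hz : ‖z‖ < 1) : -(σ * (G z).im) ≤ 0 := by
  set M : ℝ := 2 / (1 - ‖z‖) with hM
  have hM0 : 0 < M := div_pos two_pos (by linarith)
  have key : ∀ t : ℝ, 0 < t →
      -(σ * (G z).im) ≤ t * (Real.exp (M * ∫ θ, vt γ t θ ∂m) - 1) := by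
    intro t ht
    set c : ℂ := ((σ / t : ℝ) : ℂ) with hc
    set k : ℂ → ℂ := fun ζ => h ζ * (1 + Complex.I * c * G ζ) with hk
    have hvi := integrable_vt hγ hw ht
    have hkd : DifferentiableOn ℂ k (ball 0 1) :=
      hh.mul ((differentiableOn_const _).add ((differentiableOn_const _).mul hG))
    have hkb : ∀ ζ ∈ ball (0 : ℂ) 1, ‖k ζ‖ ≤ C₁ + ‖Complex.I * c‖ * C₂ := by
      intro ζ hζ
      have e : k ζ = h ζ + Complex.I * c * (h ζ * G ζ) := by simp only [hk]; ring
      rw [e]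
      refine (norm_add_le _ _).trans ?_
      rw [norm_mul (Complex.I * c)]
      gcongr
      · exact hC₁ ζ hζ
      · exact hC₂ ζ hζ
    have hnorm : ∀ x : ℝ, ‖1 + Complex.I * c * (x : ℂ)‖ = Real.exp (Real.log (1 + (x / t) ^ 2) / 2) := by
      intro x
      have h1 : 0 < 1 + (x / t) ^ 2 := by positivity
      have h2 : ‖1 + Complex.I * c * (x : ℂ)‖ ^ 2 = 1 + (x / t) ^ 2 := by
        rw [Complex.sq_norm, Complex.normSq_apply]
        simp [hc, -Complex.ofReal_div, Complex.mul_re, Complex.mul_im]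
        have : (σ / t * x) * (σ / t * x) = σ ^ 2 * (x / t) ^ 2 := by ring
        rw [this, hσ, one_mul]
      have h3 : Real.exp (Real.log (1 + (x / t) ^ 2) / 2) ^ 2 = 1 + (x / t) ^ 2 := by
        rw [← Real.exp_nat_mul]
        have : ((2 : ℕ) : ℝ) * (Real.log (1 + (x / t) ^ 2) / 2) = Real.log (1 + (x / t) ^ 2) := by
          push_cast; ring
        rw [this, Real.exp_log h1]
      exact (pow_left_inj₀ (norm_nonneg _) (Real.exp_pos _).le two_ne_zero).mp (h2.trans h3.symm)
    have hsm := smirnov_max (U := fun θ => u θ + vt γ t θ) hkd hkb hu (hu.add hvi) ?_ hz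
    · simp_rw [mul_add] at hsm
      rw [integral_add (integrable_Pk_mul_real hu hz) (integrable_Pk_mul_real hvi hz),
        Real.exp_add, ← hhu z hz] at hsm
      simp only [hk, norm_mul] at hsm
      have hpos : 0 < ‖h z‖ := by rw [hhu z hz]; exact Real.exp_pos _
      have h1 := le_of_mul_le_mul_left hsm hpos
      have h2 : 1 - σ / t * (G z).im ≤ ‖1 + Complex.I * c * G z‖ := by
        refine le_trans (le_of_eq ?_) (Complex.re_le_norm _)
        simp [hc, -Complex.ofReal_div, Complex.mul_re, Complex.mul_im]
        ring
      have h3 : ∫ θ, Pk z θ * vt γ t θ ∂m ≤ M * ∫ θ, vt γ t θ ∂m := by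
        rw [← integral_const_mul]
        apply integral_mono (integrable_Pk_mul_real hvi hz) (hvi.const_mul M)
        intro θ
        exact mul_le_mul_of_nonneg_right (Pk_le hz θ) (vt_nonneg γ t θ)
      have h4 := Real.exp_le_exp.mpr h3
      have h5 : -(σ / t * (G z).im) ≤ Real.exp (M * ∫ θ, vt γ t θ ∂m) - 1 := by linarith
      have h6 := mul_le_mul_of_nonneg_left h5 ht.le
      have h7 : t * -(σ / t * (G z).im) = -(σ * (G z).im) := by field_simp
      rw [h7] at h6
      exact h6
    · filter_upwards [hbd] with θ hθ s hs hs1 hsu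
      have hs2 : Tendsto s atTop (nhdsWithin 1 (Set.Iio 1)) :=
        tendsto_nhdsWithin_iff.mpr ⟨hs1, Filter.Eventually.of_forall fun n => (hs n).2⟩
      have hsz : ∀ n, ‖(s n : ℂ) * bd θ‖ < 1 := fun n => by
        rw [norm_r_bd (hs n).1]; exact (hs n).2
      have h1 : Tendsto (fun n => ‖h (s n * bd θ)‖) atTop (nhds (Real.exp (u θ))) := by
        simp_rw [fun n => hhu _ (hsz n)]
        exact (Real.continuous_exp.tendsto _).comp hsu
      have h2 := hθ.comp hs2
      have h3 : Tendsto (fun n => ‖1 + Complex.I * c * G (s n * bd θ)‖) atTop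
          (nhds ‖1 + Complex.I * c * (γ θ : ℂ)‖) :=
        ((h2.const_mul (Complex.I * c)).const_add 1).norm
      rw [hnorm] at h3
      have h4 := h1.mul h3
      rw [← Real.exp_add] at h4
      simp only [hk, norm_mul]
      simpa [vt] using h4
  have hx := tendsto_vt hγ hw
  have hlim : Tendsto (fun t : ℝ => 2 * M * (t * ∫ θ, vt γ t θ ∂m)) atTop (nhds 0) := by
    simpa using hx.const_mul (2 * M)
  refine ge_of_tendsto hlim ?_
  have hev : ∀ᶠ t : ℝ in atTop, 2 * M * (t * ∫ θ, vt γ t θ ∂m) ≤ 1 :=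
    hlim.eventually (Iic_mem_nhds one_pos)
  filter_upwards [hev, Filter.eventually_ge_atTop 1] with t h1 h2
  have ht : 0 < t := by linarith
  refine (key t ht).trans ?_
  have hn : 0 ≤ ∫ θ, vt γ t θ ∂m := integral_nonneg (vt_nonneg γ t)
  set x := ∫ θ, vt γ t θ ∂m with hxd
  have hMx0 : 0 ≤ M * x := by positivity
  have hMx1 : M * x ≤ 1 := by
    have : M * x ≤ t * (M * x) := le_mul_of_one_le_left hMx0 h2
    nlinarith
  have h3 := Real.abs_exp_sub_one_le (x := M * x) (by rw [abs_of_nonneg hMx0]; exact hMx1)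
  rw [abs_of_nonneg hMx0] at h3
  have h4 := (le_abs_self _).trans h3
  have h5 := mul_le_mul_of_nonneg_left h4 ht.le
  linarith

lemma const_of_im_zero {G : ℂ → ℂ} (hG : DifferentiableOn ℂ G (ball 0 1))
    (h0 : ∀ z ∈ ball (0 : ℂ) 1, (G z).im = 0) : ∃ c, ∀ z ∈ ball (0 : ℂ) 1, G z = c := by
  have ha : AnalyticOnNhd ℂ G (ball 0 1) := hG.analyticOnNhd isOpen_ball
  rcases ha.is_constant_or_isOpen (convex_ball 0 1).isPreconnected with h | h
  · exact h
  · exfalso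
    have ho := h (ball 0 1) subset_rfl isOpen_ball
    have hm : G 0 ∈ G '' ball 0 1 := ⟨0, by simp, rfl⟩
    obtain ⟨ε, hε, hsub⟩ := Metric.isOpen_iff.mp ho (G 0) hm
    have hp : G 0 + ((ε / 2 : ℝ) : ℂ) * Complex.I ∈ ball (G 0) ε := by
      rw [mem_ball, dist_eq_norm, add_sub_cancel_left, norm_mul, Complex.norm_real,
        Complex.norm_I, mul_one, Real.norm_of_nonneg (by positivity)]
      linarith
    obtain ⟨w, hw, hwe⟩ := hsub hp
    have h1 := h0 w hw
    rw [hwe, Complex.add_im, h0 0 (by simp), Complex.im_ofReal_mul, Complex.I_im] at h1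
    linarith

lemma outer_norm {h : ℂ → ℂ} (hh : OuterFn h) : ∃ u : Tc → ℝ, Integrable u m ∧
    ∀ z : ℂ, ‖z‖ < 1 → ‖h z‖ = Real.exp (∫ θ, Pk z θ * u θ ∂m) := by
  obtain ⟨_, α, w, hα, _, hi, hz⟩ := hh
  refine ⟨fun θ => Real.log (w θ), hi, fun z hz1 => ?_⟩
  rw [hz z (by simpa using hz1), norm_mul, hα, one_mul, Complex.norm_exp]
  congr 1
  exact HI_re hi hz1

lemma smirnov_hol {f g h : ℂ → ℂ} (hg : HolDisc g) (hh : HolDisc h)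
    (hne : ∀ z ∈ uDisc, h z ≠ 0) (hf : ∀ z ∈ uDisc, f z = g z / h z) : HolDisc f :=
  (DifferentiableOn.div hg hh hne).congr hf

lemma comb_const {f F : ℂ → ℂ} {fs Fs : Tc → ℂ} (hf : MemH1wk0 f fs) (hF : MemH1wk0 F Fs)
    (a b : ℂ) (γ : Tc → ℝ) (hγ : ∀ᵐ θ ∂m, a * fs θ + b * Fs θ = (γ θ : ℂ))
    (hγm : AEMeasurable γ m) (hle : ∀ θ, |γ θ| ≤ ‖fs θ‖) :
    ∃ c : ℂ, ∀ z ∈ uDisc, a * f z + b * F z = c := by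
  obtain ⟨⟨g₁, h₁, ⟨hg₁, A₁, hA₁⟩, ⟨hh₁, B₁, hB₁⟩, ho₁, hq₁⟩, hb₁, hw₁⟩ := hf
  obtain ⟨⟨g₂, h₂, ⟨hg₂, A₂, hA₂⟩, ⟨hh₂, B₂, hB₂⟩, ho₂, hq₂⟩, hb₂, hw₂⟩ := hF
  obtain ⟨u₁, hu₁, hn₁⟩ := outer_norm ho₁
  obtain ⟨u₂, hu₂, hn₂⟩ := outer_norm ho₂
  have hne₁ : ∀ z ∈ uDisc, h₁ z ≠ 0 := fun z hz => by
    rw [← norm_pos_iff, hn₁ z (by simpa using hz)]; exact Real.exp_pos _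
  have hne₂ : ∀ z ∈ uDisc, h₂ z ≠ 0 := fun z hz => by
    rw [← norm_pos_iff, hn₂ z (by simpa using hz)]; exact Real.exp_pos _
  have hfd : DifferentiableOn ℂ f (ball 0 1) := smirnov_hol hg₁ hh₁ hne₁ hq₁
  have hFd : DifferentiableOn ℂ F (ball 0 1) := smirnov_hol hg₂ hh₂ hne₂ hq₂
  set G : ℂ → ℂ := fun z => a * f z + b * F z with hG
  set h : ℂ → ℂ := fun z => h₁ z * h₂ z with hh
  have hGd : DifferentiableOn ℂ G (ball 0 1) :=
    ((differentiableOn_const _).mul hfd).add ((differentiableOn_const _).mul hFd)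
  have hhd : DifferentiableOn ℂ h (ball 0 1) := DifferentiableOn.mul hh₁ hh₂
  have hA₁0 : 0 ≤ A₁ := (norm_nonneg _).trans (hA₁ 0 (by simp))
  have hB₁0 : 0 ≤ B₁ := (norm_nonneg _).trans (hB₁ 0 (by simp))
  have hA₂0 : 0 ≤ A₂ := (norm_nonneg _).trans (hA₂ 0 (by simp))
  have hhb : ∀ z ∈ ball (0 : ℂ) 1, ‖h z‖ ≤ B₁ * B₂ := fun z hz => by
    rw [hh, norm_mul]
    exact mul_le_mul (hB₁ z hz) (hB₂ z hz) (norm_nonneg _) hB₁0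
  have hGb : ∀ z ∈ ball (0 : ℂ) 1, ‖h z * G z‖ ≤ ‖a‖ * (A₁ * B₂) + ‖b‖ * (A₂ * B₁) := by
    intro z hz
    have e : h z * G z = a * (g₁ z * h₂ z) + b * (g₂ z * h₁ z) := by
      simp only [hh, hG]
      rw [hq₁ z hz, hq₂ z hz]
      have := hne₁ z hz
      have := hne₂ z hz
      field_simp
    rw [e]
    refine (norm_add_le _ _).trans ?_
    simp only [norm_mul]
    gcongr
    · exact hA₁ z hz
    · exact hB₂ z hz
    · exact hA₂ z hz
    · exact hB₁ z hz
  have hnorm : ∀ z : ℂ, ‖z‖ < 1 → ‖h z‖ = Real.exp (∫ θ, Pk z θ * (u₁ θ + u₂ θ) ∂m) := by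
    intro z hz
    simp_rw [mul_add]
    rw [integral_add (integrable_Pk_mul_real hu₁ hz) (integrable_Pk_mul_real hu₂ hz),
      Real.exp_add, ← hn₁ z hz, ← hn₂ z hz, hh, norm_mul]
  have hbd : IsBdry G (fun θ => (γ θ : ℂ)) := by
    unfold IsBdry at *
    filter_upwards [hb₁, hb₂, hγ] with θ t₁ t₂ t₃
    rw [← t₃]
    exact (t₁.const_mul a).add (t₂.const_mul b)
  have hwk : Wk γ := by
    unfold Wk
    refine tendsto_of_tendsto_of_tendsto_of_le_of_le' tendsto_const_nhds hw₁.2 ?_ ?_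
    · filter_upwards [Filter.eventually_ge_atTop 0] with t ht
      exact mul_nonneg ht ENNReal.toReal_nonneg
    · filter_upwards [Filter.eventually_ge_atTop 0] with t ht
      apply mul_le_mul_of_nonneg_left _ ht
      apply ENNReal.toReal_mono (measure_ne_top _ _)
      exact measure_mono fun θ (hθ : t < |γ θ|) => lt_of_lt_of_le hθ (hle θ)
  apply const_of_im_zero hGd
  intro z hz
  have hz' : ‖z‖ < 1 := by simpa using hz
  have i1 := im_nonneg_aux hGd hhd hhb hGb (hu₁.add hu₂) hnorm hbd hγm hwk (σ := 1) (by norm_num) hz'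
  have i2 := im_nonneg_aux hGd hhd hhb hGb (hu₁.add hu₂) hnorm hbd hγm hwk (σ := -1) (by norm_num) hz'
  linarith

/-- If `f ∈ H₀^{1,∞}` and some `F ∈ H₀^{1,∞}` has boundary function equal
a.e. to the complex conjugate of that of `f`, then `f` is constant on `𝔻`. -/
theorem stmt_1 (f : ℂ → ℂ) (fs : Tc → ℂ) (hf : MemH1wk0 f fs)
    (F : ℂ → ℂ) (Fs : Tc → ℂ) (hF : MemH1wk0 F Fs)
    (hconj : Fs =ᵐ[m] fun θ => conj (fs θ)) :
    ∃ c : ℂ, ∀ z ∈ uDisc, f z = c := by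
  have hfm : AEMeasurable fs m := hf.2.2.1.aemeasurable
  obtain ⟨c₁, h₁⟩ := comb_const hf hF (1 / 2) (1 / 2) (fun θ => (fs θ).re) (by
    filter_upwards [hconj] with θ hθ
    rw [hθ, Complex.re_eq_add_conj]; ring) (Complex.measurable_re.comp_aemeasurable hfm)
    (fun θ => Complex.abs_re_le_norm _)
  obtain ⟨c₂, h₂⟩ := comb_const hf hF (1 / (2 * Complex.I)) (-(1 / (2 * Complex.I)))
    (fun θ => (fs θ).im) (by
    filter_upwards [hconj] with θ hθ
    rw [hθ, Complex.im_eq_sub_conj]; ring) (Complex.measurable_im.comp_aemeasurable hfm)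
    (fun θ => Complex.abs_im_le_norm _)
  refine ⟨c₁ + Complex.I * c₂, fun z hz => ?_⟩
  rw [← h₁ z hz, ← h₂ z hz]
  have : Complex.I ≠ 0 := Complex.I_ne_zero
  field_simp
  ring

end
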